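/- The quantity (Σ_{n=1}^{N} ω(n)) / (N · log log N) tends to 1 as N → ∞, where ω(n) is the number of distinct prime divisors of n. In other words, the average number of distinct prime divisors of the integers up to N is asymptotic to log log N. -/

import Mathlib

open Finset in
/-- Partial summation with logarithmic weights: if `∑_{k ≤ n} a k * log k = log n + O(1)`,
then `∑_{k ≤ n} a k = log log n + O(1)`. -/
theorem exists_abs_sum_sub_log_log_le {a : ℕ → ℝ} {C : ℝ}
    (h : ∀ n : ℕ, 2 ≤ n → |∑ k ∈ range (n + 1), a k * Real.log k - Real.log n| ≤ C) :
    ∃ K : ℝ, ∀ n : ℕ, 2 ≤ n → |∑ k ∈ range (n + 1), a k - Real.log (Real.log n)| ≤ K := by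
  set S : ℕ → ℝ := fun n ↦ ∑ k ∈ range (n + 1), a k with hS
  set R : ℕ → ℝ := fun n ↦ ∑ k ∈ range (n + 1), a k * Real.log k - Real.log n with hR
  set D : ℕ → ℝ := fun n ↦ S n - R n / Real.log n - Real.log (Real.log n) with hD
  have hlog (n : ℕ) (hn : 2 ≤ n) : 0 < Real.log n := Real.log_pos (by exact_mod_cast hn)
  have hC : 0 ≤ C := (abs_nonneg _).trans (h 2 le_rfl)
  have hstep (n : ℕ) (hn : 2 ≤ n) :
      |D (n + 1) - D n| ≤ (C + 1) * (1 / Real.log n - 1 / Real.log (n + 1 : ℕ)) := by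
    have hx := hlog n hn
    have hy := hlog (n + 1) (by omega)
    have hn' : (2 : ℝ) ≤ n := by exact_mod_cast hn
    have hxy : Real.log n ≤ Real.log (n + 1 : ℕ) :=
      Real.log_le_log (by positivity) (by push_cast; linarith)
    have hRn := abs_le.1 (h n hn)
    have hu : Real.log (n + 1 : ℕ) - Real.log n ≤ 1 := by
      rw [← Real.log_div (by positivity) (by positivity)]
      refine (Real.log_le_sub_one_of_pos (by positivity)).trans ?_
      rw [sub_le_iff_le_add, div_le_iff₀ (by positivity)]
      push_cast
      linarith
    have hS' : S (n + 1) = S n + a (n + 1) := sum_range_succ _ _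
    have hR' : R (n + 1) = R n + a (n + 1) * Real.log (n + 1 : ℕ)
        - (Real.log (n + 1 : ℕ) - Real.log n) := by
      simp only [hR]
      rw [sum_range_succ _ (n + 1)]
      ring
    change -C ≤ R n ∧ R n ≤ C at hRn
    have hll := Real.log_le_sub_one_of_pos (div_pos hy hx)
    have hlu := Real.log_le_sub_one_of_pos (div_pos hx hy)
    rw [Real.log_div hy.ne' hx.ne'] at hll
    rw [Real.log_div hx.ne' hy.ne'] at hlu
    have key : D (n + 1) - D n = R n * (1 / Real.log n - 1 / Real.log (n + 1 : ℕ))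
        + (1 - Real.log n / Real.log (n + 1 : ℕ))
        - (Real.log (Real.log (n + 1 : ℕ)) - Real.log (Real.log n)) := by
      simp only [hD]
      rw [hS', hR']
      field_simp
      ring
    rw [key]
    generalize Real.log (n + 1 : ℕ) = y at *
    generalize Real.log n = x at *
    have hd : 0 ≤ 1 / x - 1 / y := sub_nonneg.2 (one_div_le_one_div_of_le hx hxy)
    have he : (y / x - 1) - (1 - x / y) ≤ 1 / x - 1 / y := by
      have : (y / x - 1) - (1 - x / y) = (y - x) * (1 / x - 1 / y) := by
        field_simp
      rw [this]
      nlinarith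
    rw [abs_le]
    constructor <;> nlinarith
  have hbound (n : ℕ) (hn : 2 ≤ n) :
      |D n| ≤ |D 2| + (C + 1) * (1 / Real.log 2 - 1 / Real.log n) := by
    induction n, hn using Nat.le_induction with
    | base => simp
    | succ n hn ih =>
      have := abs_sub_abs_le_abs_sub (D (n + 1)) (D n)
      linarith [hstep n hn]
  refine ⟨|D 2| + (C + 1) / Real.log 2 + C / Real.log 2, fun n hn ↦ ?_⟩
  have hx := hlog n hn
  have h2 := hlog 2 le_rfl
  push_cast at h2
  have hle : Real.log 2 ≤ Real.log n := Real.log_le_log (by norm_num) (by exact_mod_cast hn)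
  have hRn : |R n / Real.log n| ≤ C / Real.log 2 := by
    rw [abs_div, abs_of_pos hx]
    exact div_le_div₀ hC (h n hn) h2 hle
  have hDn : |D n| ≤ |D 2| + (C + 1) / Real.log 2 := by
    refine (hbound n hn).trans ?_
    have : 0 ≤ (C + 1) * (1 / Real.log n) := by positivity
    rw [mul_sub, mul_one_div]
    linarith
  have : S n - Real.log (Real.log n) = D n + R n / Real.log n := by
    simp only [hD]
    ring
  calc |S n - Real.log (Real.log n)| ≤ |D n| + |R n / Real.log n| := this ▸ abs_add_le _ _
    _ ≤ _ := add_le_add hDn hRn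

open Nat in
theorem log_factorial_eq_sum_primesLE (n : ℕ) :
    Real.log (n ! : ℕ) = ∑ p ∈ primesLE n, ((n !).factorization p : ℝ) * Real.log p := by
  rw [Real.log_nat_eq_sum_factorization, Finsupp.sum]
  refine Finset.sum_subset (fun p hp ↦ ?_) fun p _ hp ↦ ?_
  · have hp' := prime_of_mem_primeFactors hp
    exact mem_primesLE.2 ⟨(hp'.dvd_factorial).1 (dvd_of_mem_primeFactors hp), hp'⟩
  · rw [Finsupp.notMem_support_iff.1 hp]
    simp

open Nat in
theorem div_le_factorization_factorial {p : ℕ} (hp : p.Prime) (n : ℕ) :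
    n / p ≤ (n !).factorization p := by
  rw [factorization_factorial hp (b := Nat.log p n + 2) (by omega)]
  refine le_of_eq_of_le (by simp) (Finset.single_le_sum (f := fun i ↦ n / p ^ i)
    (fun _ _ ↦ Nat.zero_le _) (Finset.mem_Ico.2 ⟨le_rfl, ?_⟩))
  omega

theorem log_div_mul_sub_one_le {p : ℕ} (hp : 2 ≤ p) :
    Real.log p / (p * (p - 1)) ≤ 4 * (1 / (p : ℝ) ^ (3 / 2 : ℝ)) := by
  have hp' : (2 : ℝ) ≤ p := by exact_mod_cast hp
  have hlog := Real.log_le_rpow_div (x := p) (by positivity) (ε := 1 / 2) (by norm_num)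
  have hrpow : (p : ℝ) ^ (3 / 2 : ℝ) * (p : ℝ) ^ (1 / 2 : ℝ) = p * p := by
    rw [← Real.rpow_add (by positivity)]
    norm_num
    ring
  have hpos : 0 < (p : ℝ) ^ (3 / 2 : ℝ) := by positivity
  rw [mul_one_div, div_le_div_iff₀ (by nlinarith) hpos]
  calc Real.log p * (p : ℝ) ^ (3 / 2 : ℝ)
      ≤ ((p : ℝ) ^ (1 / 2 : ℝ) / (1 / 2)) * (p : ℝ) ^ (3 / 2 : ℝ) := by gcongr
    _ = 2 * (p * p) := by rw [← hrpow]; ring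
    _ ≤ 4 * (p * (p - 1)) := by nlinarith

open Nat in
/-- Mertens' first theorem: `∑_{p ≤ n} log p / p = log n + O(1)`. -/
theorem exists_abs_sum_log_div_prime_sub_log_le :
    ∃ C : ℝ, ∀ n : ℕ, 1 ≤ n → |∑ p ∈ primesLE n, Real.log p / p - Real.log n| ≤ C := by
  have hsum : Summable fun p : ℕ ↦ 4 * (1 / (p : ℝ) ^ (3 / 2 : ℝ)) :=
    (Real.summable_one_div_nat_rpow.2 (by norm_num)).mul_left 4
  set B := ∑' p : ℕ, 4 * (1 / (p : ℝ) ^ (3 / 2 : ℝ))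
  have hB : 0 ≤ B := tsum_nonneg fun p ↦ by positivity
  have hlog4 : 0 ≤ Real.log 4 := Real.log_nonneg (by norm_num)
  refine ⟨B + 1 + Real.log 4, fun n hn ↦ ?_⟩
  have hn' : (0 : ℝ) < n := by exact_mod_cast hn
  have hfact := log_factorial_eq_sum_primesLE n
  have hupper : Real.log (n ! : ℕ) ≤ n * Real.log n := by
    rw [← Real.log_pow]
    exact Real.log_le_log (by positivity) (by exact_mod_cast factorial_le_pow n)
  have hlower : n * Real.log n - n ≤ Real.log (n ! : ℕ) := by
    have h1 := Stirling.le_log_factorial_stirling (by omega : n ≠ 0)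
    have h2 : 0 ≤ Real.log n := Real.log_natCast_nonneg n
    have h3 : 0 ≤ Real.log (2 * Real.pi) := Real.log_nonneg (by linarith [Real.pi_gt_three])
    linarith
  have htheta : ∑ p ∈ primesLE n, Real.log p ≤ Real.log 4 * n := by
    rw [← Chebyshev.theta_eq_sum_primesLE_log]
    exact Chebyshev.theta_le_log4_mul_x hn'.le
  have hge : n * ∑ p ∈ primesLE n, Real.log p / p - ∑ p ∈ primesLE n, Real.log p
      ≤ Real.log (n ! : ℕ) := by
    rw [hfact, Finset.mul_sum, ← Finset.sum_sub_distrib]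
    refine Finset.sum_le_sum fun p hp ↦ ?_
    have hp' := (mem_primesLE.1 hp).2
    have h1 : (n : ℝ) / p - 1 ≤ ((n !).factorization p : ℝ) := by
      have h2 := (Nat.sub_one_lt_floor ((n : ℝ) / p)).le
      rw [Nat.floor_div_eq_div] at h2
      exact h2.trans (by exact_mod_cast div_le_factorization_factorial hp' n)
    calc (n : ℝ) * (Real.log p / p) - Real.log p = (n / p - 1) * Real.log p := by ring
      _ ≤ _ := by gcongr
  have hle : Real.log (n ! : ℕ) ≤ n * ∑ p ∈ primesLE n, Real.log p / p + n * B := by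
    have hBn : ∑ p ∈ primesLE n, Real.log p / (p * (p - 1)) ≤ B :=
      (Finset.sum_le_sum fun p hp ↦ log_div_mul_sub_one_le (mem_primesLE.1 hp).2.two_le).trans
        (hsum.sum_le_tsum _ fun p _ ↦ by positivity)
    refine le_trans ?_ (add_le_add_right (mul_le_mul_of_nonneg_left hBn hn'.le) _)
    rw [hfact, Finset.mul_sum, Finset.mul_sum, ← Finset.sum_add_distrib]
    refine Finset.sum_le_sum fun p hp ↦ ?_
    have hp' := (mem_primesLE.1 hp).2
    have hp2 : (2 : ℝ) ≤ p := by exact_mod_cast hp'.two_le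
    have h1 : ((n !).factorization p : ℝ) ≤ n / (p - 1) := by
      have h2 : ((n !).factorization p : ℝ) ≤ (n / (p - 1) : ℕ) := by
        exact_mod_cast factorization_factorial_le_div_pred hp' n
      refine h2.trans (Nat.cast_div_le.trans_eq ?_)
      rw [Nat.cast_sub hp'.one_le, Nat.cast_one]
    have hp1 : (p : ℝ) - 1 ≠ 0 := by linarith
    calc ((n !).factorization p : ℝ) * Real.log p ≤ n / (p - 1) * Real.log p := by gcongr
      _ = _ := by field_simp; ring
  rw [abs_le]
  constructor
  · refine le_of_mul_le_mul_left ?_ hn'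
    nlinarith
  · refine le_of_mul_le_mul_left ?_ hn'
    nlinarith

open Nat in
/-- A weak form of Mertens' second theorem: `∑_{p ≤ n} 1 / p = log log n + O(1)`. -/
theorem exists_abs_sum_one_div_prime_sub_log_log_le :
    ∃ K : ℝ, ∀ n : ℕ, 2 ≤ n →
      |∑ p ∈ primesLE n, (1 : ℝ) / p - Real.log (Real.log n)| ≤ K := by
  obtain ⟨C, hC⟩ := exists_abs_sum_log_div_prime_sub_log_le
  simp only [primesLE_eq_filter_range, Finset.sum_filter] at hC ⊢
  refine exists_abs_sum_sub_log_log_le (C := C) fun n hn ↦ ?_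
  simpa only [ite_mul, zero_mul, one_div_mul_eq_div] using hC n (by omega)

open Nat Finset in
theorem sum_card_primeFactors_eq_sum_div (N : ℕ) :
    ∑ n ∈ Icc 1 N, n.primeFactors.card = ∑ p ∈ primesLE N, N / p := by
  have hcard (n : ℕ) (hn : n ∈ Icc 1 N) :
      n.primeFactors.card = ∑ p ∈ primesLE N, if p ∣ n then 1 else 0 := by
    rw [← card_filter]
    congr 1
    ext p
    rw [mem_Icc] at hn
    simp only [mem_primeFactors, mem_filter, mem_primesLE]
    exact ⟨fun h ↦ ⟨⟨(Nat.le_of_dvd hn.1 h.2.1).trans hn.2, h.1⟩, h.2.1⟩,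
      fun h ↦ ⟨h.1.2, h.2, by omega⟩⟩
  rw [sum_congr rfl hcard, sum_comm]
  refine sum_congr rfl fun p _ ↦ ?_
  rw [← card_filter, ← Nat.Ioc_filter_dvd_card_eq_div N p]
  rfl

open Nat Finset in
theorem abs_sum_card_primeFactors_sub_le (N : ℕ) :
    |∑ n ∈ Icc 1 N, (n.primeFactors.card : ℝ) - N * ∑ p ∈ primesLE N, (1 : ℝ) / p| ≤ N := by
  have hcard : (primesLE N).card ≤ N := by
    have hsub : primesLE N ⊆ Ioc 0 N := fun p hp ↦ by
      have := mem_primesLE.1 hp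
      exact mem_Ioc.2 ⟨this.2.pos, this.1⟩
    simpa using card_le_card hsub
  rw [← Nat.cast_sum, sum_card_primeFactors_eq_sum_div, Nat.cast_sum, mul_sum, ← sum_sub_distrib]
  refine (abs_sum_le_sum_abs _ _).trans ?_
  refine (sum_le_card_nsmul _ _ 1 fun p _ ↦ ?_).trans (by simpa using hcard)
  rw [mul_one_div, ← Nat.floor_div_eq_div (K := ℝ), abs_le]
  have h1 := Nat.sub_one_lt_floor ((N : ℝ) / p)
  have h2 := Nat.floor_le (show 0 ≤ (N : ℝ) / p by positivity)
  constructor <;> linarith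

open Filter in
/-- The average number of distinct prime divisors of the integers up to `N` is
asymptotic to `log log N`:  `(Σ_{n=1}^{N} ω(n)) / (N · log log N) → 1`. -/
theorem avg_card_primeFactors_asymptotic :
    Tendsto (fun N : ℕ =>
        (∑ n ∈ Finset.Icc 1 N, (n.primeFactors.card : ℝ)) /
          (N * Real.log (Real.log N)))
      atTop (nhds 1) := by
  obtain ⟨K, hK⟩ := exists_abs_sum_one_div_prime_sub_log_log_le
  have hL : Tendsto (fun N : ℕ ↦ Real.log (Real.log N)) atTop atTop :=
    Real.tendsto_log_atTop.comp (Real.tendsto_log_atTop.comp tendsto_natCast_atTop_atTop)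
  rw [tendsto_iff_norm_sub_tendsto_zero]
  refine squeeze_zero' (Eventually.of_forall fun _ ↦ norm_nonneg _) ?_
    (hL.const_div_atTop (1 + K))
  filter_upwards [eventually_ge_atTop 2, hL.eventually_gt_atTop 0] with N hN hpos
  have hN' : (0 : ℝ) < N := by exact_mod_cast (by omega : 0 < N)
  rw [div_sub_one (by positivity), Real.norm_eq_abs, abs_div, abs_of_pos (mul_pos hN' hpos),
    div_le_div_iff₀ (mul_pos hN' hpos) hpos]
  have h1 := abs_le.1 (abs_sum_card_primeFactors_sub_le N)
  have h2 := abs_le.1 (hK N hN)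
  have h3 : |∑ n ∈ Finset.Icc 1 N, (n.primeFactors.card : ℝ) - N * Real.log (Real.log N)|
      ≤ (1 + K) * N := by
    rw [abs_le]
    constructor <;> nlinarith
  calc _ ≤ (1 + K) * N * Real.log (Real.log N) := by gcongr
    _ = _ := by ring
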